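/- arXiv:1107.1670 — 2 statements merged into one kernel-verified Lean document; each statement's English description precedes it below -/
import Mathlib

section
/- Let 1 ≤ p < ∞. For every sequence (x_n) ∈ ℓ_p (of scalars) and every ε > 0, there exists a sequence β = (β_n) in the closed unit ball of c₀ with β_n ≠ 0 for all n, such that the sequence (x_n/β_n) belongs to ℓ_p and ‖(x_n/β_n)‖_{ℓ_p} ≤ ‖(x_n)‖_{ℓ_p}(1+ε). -/
open Filter

theorem exists_pos_tendsto_atTop_summable_mul {a : ℕ → ℝ} (ha : ∀ n, 0 ≤ a n)
    (hs : Summable a) :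
    ∃ v : ℕ → ℝ, (∀ n, 0 < v n) ∧ Tendsto v atTop atTop ∧ Summable fun n => a n * v n := by
  set b : ℕ → ℝ := fun n => a n + (1 / 2) ^ n with hb
  have hbs : Summable b := hs.add summable_geometric_two
  have hb0 : ∀ n, 0 < b n := fun n => add_pos_of_nonneg_of_pos (ha n) (by positivity)
  set r : ℕ → ℝ := fun n => ∑' k, b (k + n) with hr
  have hrs : ∀ n, Summable fun k => b (k + n) := fun n => (summable_nat_add_iff n).2 hbs
  have hr0 : ∀ n, 0 < r n := fun n => (hrs n).tsum_pos (fun k => (hb0 _).le) 0 (hb0 _)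
  have hrec : ∀ n, r n = b n + r (n + 1) := fun n => by
    simp only [hr]
    rw [(hrs n).tsum_eq_zero_add]
    simp [add_comm, add_left_comm]
  have hrlim : Tendsto r atTop (nhds 0) := tendsto_sum_nat_add b
  refine ⟨fun n => (√(r n))⁻¹, fun n => inv_pos.2 (Real.sqrt_pos.2 (hr0 n)), ?_, ?_⟩
  · refine Tendsto.inv_tendsto_nhdsGT_zero (tendsto_nhdsWithin_iff.2 ⟨?_, ?_⟩)
    · simpa using hrlim.sqrt
    · exact Eventually.of_forall fun n => Real.sqrt_pos.2 (hr0 n)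
  · have hterm : ∀ n, a n * (√(r n))⁻¹ ≤ 2 * (√(r n) - √(r (n + 1))) := fun n => by
      have h1 := Real.sqrt_pos.2 (hr0 n)
      have h3 := Real.sq_sqrt (hr0 n).le
      have h4 := Real.sq_sqrt (hr0 (n + 1)).le
      have h5 : a n ≤ b n := le_add_of_nonneg_right (by positivity)
      rw [← div_eq_mul_inv, div_le_iff₀ h1]
      nlinarith [hrec n, sq_nonneg (√(r n) - √(r (n + 1)))]
    refine summable_of_sum_range_le (c := 2 * √(r 0))
      (fun n => mul_nonneg (ha n) (by positivity)) fun n => ?_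
    calc ∑ i ∈ Finset.range n, a i * (√(r i))⁻¹
        ≤ ∑ i ∈ Finset.range n, 2 * (√(r i) - √(r (i + 1))) :=
          Finset.sum_le_sum fun i _ => hterm i
      _ = 2 * (√(r 0) - √(r n)) := by rw [← Finset.mul_sum, Finset.sum_range_sub']
      _ ≤ 2 * √(r 0) := by linarith [Real.sqrt_nonneg (r n)]

theorem exists_one_le_tendsto_atTop_tsum_mul_le {a : ℕ → ℝ} (ha : ∀ n, 0 ≤ a n)
    (hs : Summable a) {δ : ℝ} (hδ : 0 < δ) :
    ∃ w : ℕ → ℝ, (∀ n, 1 ≤ w n) ∧ Tendsto w atTop atTop ∧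
      (Summable fun n => a n * w n) ∧ ∑' n, a n * w n ≤ ∑' n, a n + δ := by
  obtain ⟨v, hv0, hv, hav⟩ := exists_pos_tendsto_atTop_summable_mul ha hs
  have hV : 0 ≤ ∑' n, a n * v n := tsum_nonneg fun n => mul_nonneg (ha n) (hv0 n).le
  set V := ∑' n, a n * v n
  have hc : 0 < δ / (V + 1) := by positivity
  have heq : (fun n => a n * (1 + δ / (V + 1) * v n)) =
      fun n => a n + δ / (V + 1) * (a n * v n) := by
    funext n
    ring
  refine ⟨fun n => 1 + δ / (V + 1) * v n, fun n => ?_, ?_, ?_, ?_⟩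
  · have := mul_pos hc (hv0 n)
    linarith
  · exact tendsto_atTop_add_const_left _ _ (hv.const_mul_atTop hc)
  · rw [heq]
    exact hs.add (hav.mul_left _)
  · rw [heq, hs.tsum_add (hav.mul_left _), tsum_mul_left]
    gcongr
    change δ / (V + 1) * V ≤ δ
    rw [div_mul_eq_mul_div, div_le_iff₀ (by positivity)]
    nlinarith

/-- **Lemma 2.2 (technical lemma).** Let `1 ≤ p < ∞`. Given a scalar sequence
`(x_n) ∈ ℓ_p` and `ε > 0`, there exists `β = (β_n)` in the closed unit ball of `c₀`
(a null sequence with `‖β_n‖ ≤ 1`), with `β_n ≠ 0` for all `n`, such that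
`(x_n / β_n) ∈ ℓ_p` and `‖(x_n / β_n)‖_p ≤ ‖(x_n)‖_p (1 + ε)`. -/
theorem statement0 (p : ℝ) (hp : 1 ≤ p) (x : ℕ → ℂ)
    (hx : Summable fun n => ‖x n‖ ^ p) (ε : ℝ) (hε : 0 < ε) :
    ∃ β : ℕ → ℂ,
      (∀ n, β n ≠ 0) ∧
      Tendsto β atTop (nhds 0) ∧
      (∀ n, ‖β n‖ ≤ 1) ∧
      (Summable fun n => ‖x n / β n‖ ^ p) ∧
      (∑' n, ‖x n / β n‖ ^ p) ^ (1 / p) ≤ (∑' n, ‖x n‖ ^ p) ^ (1 / p) * (1 + ε) := by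
  have hp0 : 0 < p := by linarith
  have ha : ∀ n, 0 ≤ ‖x n‖ ^ p := fun n => by positivity
  have hS : 0 ≤ ∑' n, ‖x n‖ ^ p := tsum_nonneg ha
  obtain ⟨w, hw1, hw, haw, hle⟩ : ∃ w : ℕ → ℝ, (∀ n, 1 ≤ w n) ∧ Tendsto w atTop atTop ∧
      (Summable fun n => ‖x n‖ ^ p * w n) ∧
      ∑' n, ‖x n‖ ^ p * w n ≤ (∑' n, ‖x n‖ ^ p) * (1 + ε) ^ p := by
    rcases hS.eq_or_lt with h0 | hpos
    · obtain ⟨w, hw1, hw, haw, -⟩ := exists_one_le_tendsto_atTop_tsum_mul_le ha hx one_pos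
      have hz : ∀ n, ‖x n‖ ^ p = 0 :=
        congrFun ((hasSum_zero_iff_of_nonneg ha).1 (h0 ▸ hx.hasSum))
      exact ⟨w, hw1, hw, haw, by simp [hz]⟩
    · have h1 : 1 < (1 + ε) ^ p := Real.one_lt_rpow (by linarith) hp0
      obtain ⟨w, hw1, hw, haw, hle⟩ := exists_one_le_tendsto_atTop_tsum_mul_le ha hx
        (mul_pos hpos (sub_pos.2 h1))
      exact ⟨w, hw1, hw, haw, hle.trans_eq (by ring)⟩
  have hw0 : ∀ n, 0 < w n := fun n => one_pos.trans_le (hw1 n)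
  set β : ℕ → ℂ := fun n => ((w n ^ (-(1 / p)) : ℝ) : ℂ) with hβ
  have hβn : ∀ n, ‖β n‖ = w n ^ (-(1 / p)) := fun n => by
    simp only [hβ, Complex.norm_real, Real.norm_eq_abs]
    exact abs_of_pos (Real.rpow_pos_of_pos (hw0 n) _)
  have hdiv : (fun n => ‖x n / β n‖ ^ p) = fun n => ‖x n‖ ^ p * w n := by
    funext n
    rw [norm_div, hβn, Real.rpow_neg (hw0 n).le, div_inv_eq_mul,
      Real.mul_rpow (norm_nonneg _) (Real.rpow_nonneg (hw0 n).le _), ← Real.rpow_mul (hw0 n).le,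
      one_div_mul_cancel hp0.ne', Real.rpow_one]
  refine ⟨β, fun n => ?_, ?_, fun n => ?_, ?_, ?_⟩
  · rw [← norm_pos_iff, hβn]
    exact Real.rpow_pos_of_pos (hw0 n) _
  · rw [tendsto_zero_iff_norm_tendsto_zero]
    simp only [hβn]
    exact (tendsto_rpow_neg_atTop (one_div_pos.2 hp0)).comp hw
  · rw [hβn]
    exact Real.rpow_le_one_of_one_le_of_nonpos (hw1 n) (by simpa using hp0.le)
  · rwa [hdiv]
  · rw [hdiv]
    calc (∑' n, ‖x n‖ ^ p * w n) ^ (1 / p)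
        ≤ ((∑' n, ‖x n‖ ^ p) * (1 + ε) ^ p) ^ (1 / p) :=
          Real.rpow_le_rpow (tsum_nonneg fun n => mul_nonneg (ha n) (hw0 n).le) hle
            (by positivity)
      _ = (∑' n, ‖x n‖ ^ p) ^ (1 / p) * (1 + ε) := by
          rw [Real.mul_rpow hS (by positivity), ← Real.rpow_mul (by positivity),
            mul_one_div_cancel hp0.ne', Real.rpow_one]
end

section
/- Let E and F be Banach spaces, 1 ≤ p < ∞, and P : E → F a continuous m-homogeneous polynomial. Then P is p-compact if and only if there exist a closed subspace N of ℓ_q (for p = 1, of c₀), a continuous m-homogeneous polynomial Q : E → ℓ_q/N, a closed subspace M of ℓ₁, a p-compact linear operator R : ℓ_q/N → ℓ₁/M and a compact linear operator S : ℓ₁/M → F such that P = S ∘ R ∘ Q. Moreover, in this case κ_p(P) = inf{‖Q‖ κ_p(R) ‖S‖}, the infimum taken over all such factorizations. -/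
open scoped ENNReal NNReal Classical ZeroAtInfty
open Filter Metric

noncomputable section

/-- Membership in the closed unit ball of `ℓ_q`, where `q` is the conjugate exponent of `p`
(`q = ∞`, i.e. bounded coefficients, when `p = 1`). -/
def ConjUnitBall (p : ℝ) (α : ℕ → ℂ) : Prop :=
  if p = 1 then ∀ n, ‖α n‖ ≤ 1
  else (Summable fun n => ‖α n‖ ^ (p / (p - 1))) ∧ (∑' n, ‖α n‖ ^ (p / (p - 1))) ≤ 1

/-- The `p`-convex hull `p-co{x_n}` of a sequence `(x_n)`. -/
def pCo {F : Type*} [SeminormedAddCommGroup F] [NormedSpace ℂ F]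
    (p : ℝ) (x : ℕ → F) : Set F :=
  {y | ∃ α : ℕ → ℂ, ConjUnitBall p α ∧ HasSum (fun n => α n • x n) y}

/-- A set is relatively `p`-compact if it is contained in the `p`-convex hull of a
`p`-summable sequence. -/
def IsRelPCompact {F : Type*} [SeminormedAddCommGroup F] [NormedSpace ℂ F]
    (p : ℝ) (K : Set F) : Prop :=
  ∃ x : ℕ → F, (Summable fun n => ‖x n‖ ^ p) ∧ K ⊆ pCo p x

/-- The measure of `p`-compactness `m_p(K)`. -/
def mP {F : Type*} [SeminormedAddCommGroup F] [NormedSpace ℂ F]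
    (p : ℝ) (K : Set F) : ℝ :=
  sInf {r : ℝ | ∃ x : ℕ → F, (Summable fun n => ‖x n‖ ^ p) ∧ K ⊆ pCo p x ∧
    r = (∑' n, ‖x n‖ ^ p) ^ (1 / p)}

/-- The `m`-homogeneous polynomial associated to a continuous `m`-linear map. -/
def polyEval {E F : Type*} [SeminormedAddCommGroup E] [NormedSpace ℂ E]
    [SeminormedAddCommGroup F] [NormedSpace ℂ F] {m : ℕ}
    (A : ContinuousMultilinearMap ℂ (fun _ : Fin m => E) F) (x : E) : F :=
  A fun _ => x

/-- The supremum norm of a map over the closed unit ball. -/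
def supNorm {E F : Type*} [SeminormedAddCommGroup E] [SeminormedAddCommGroup F]
    (P : E → F) : ℝ :=
  sSup {r : ℝ | ∃ x ∈ closedBall (0 : E) 1, r = ‖P x‖}

/-- The set of values `‖Q‖ ⬝ κ_p(R) ⬝ ‖S‖` over all factorizations `P = S ∘ R ∘ Q`, where
`N` is a closed subspace of `D`, `Q` is a continuous `m`-homogeneous polynomial with values
in `D ⧸ N`, `M` is a closed subspace of `ℓ₁`, `R : D ⧸ N → ℓ₁ ⧸ M` is a `p`-compact
operator and `S : ℓ₁ ⧸ M → F` is a compact operator. -/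
def FactorNormsViaL1 (p : ℝ) {E F : Type*} [SeminormedAddCommGroup E] [NormedSpace ℂ E]
    [SeminormedAddCommGroup F] [NormedSpace ℂ F] {m : ℕ}
    (A : ContinuousMultilinearMap ℂ (fun _ : Fin m => E) F)
    (D : Type*) [SeminormedAddCommGroup D] [NormedSpace ℂ D] : Set ℝ :=
  {r : ℝ | ∃ N : Submodule ℂ D, IsClosed (N : Set D) ∧
    ∃ (Q : ContinuousMultilinearMap ℂ (fun _ : Fin m => E) (D ⧸ N))
      (M : Submodule ℂ (lp (fun _ : ℕ => ℂ) 1)),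
      IsClosed (M : Set (lp (fun _ : ℕ => ℂ) 1)) ∧
      ∃ (R : (D ⧸ N) →L[ℂ] ((lp (fun _ : ℕ => ℂ) 1) ⧸ M))
        (S : ((lp (fun _ : ℕ => ℂ) 1) ⧸ M) →L[ℂ] F),
        IsRelPCompact p (⇑R '' closedBall 0 1) ∧
        IsCompact (closure (⇑S '' closedBall 0 1)) ∧
        (∀ x : E, polyEval A x = S (R (polyEval Q x))) ∧
        r = supNorm (polyEval Q) * mP p (⇑R '' closedBall 0 1) * ‖S‖}

open scoped Topology

/-! ### Polarization -/

/-- The polarization formula for symmetric multilinear maps. -/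
theorem MultilinearMap.sum_powerset_polarization {R V W : Type*} [CommRing R] [AddCommGroup V]
    [Module R V] [AddCommGroup W] [Module R W] {m : ℕ}
    (A : MultilinearMap R (fun _ : Fin m => V) W)
    (hsym : ∀ (v : Fin m → V) (σ : Equiv.Perm (Fin m)), A (v ∘ σ) = A v) (v : Fin m → V) :
    ∑ s : Finset (Fin m), (-1 : R) ^ s.card • A (fun _ => ∑ i ∈ s, v i) =
      ((-1 : R) ^ m * (m.factorial : R)) • A v := by
  have key : ∀ f : Fin m → Fin m,
      ∑ s : Finset (Fin m), (if ∀ i, f i ∈ s then (-1 : R) ^ s.card else 0) =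
        if Function.Bijective f then (-1 : R) ^ m else 0 := by
    intro f
    have h := Finset.prod_add (fun _ : Fin m => (-1 : R))
      (fun i => if i ∈ Set.range f then 0 else 1) Finset.univ
    have h2 : ∀ s : Finset (Fin m), (∏ i ∈ s, (-1 : R)) *
        ∏ i ∈ Finset.univ \ s, (if i ∈ Set.range f then (0 : R) else 1) =
        if ∀ i, f i ∈ s then (-1 : R) ^ s.card else 0 := by
      intro s
      rw [Finset.prod_const]
      split_ifs with hs
      · rw [Finset.prod_eq_one, mul_one]
        intro i hi
        rw [if_neg]
        rintro ⟨j, rfl⟩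
        simp [hs j] at hi
      · push Not at hs
        obtain ⟨j, hj⟩ := hs
        rw [Finset.prod_eq_zero (i := f j), mul_zero]
        · simp [hj]
        · simp
    rw [Finset.sum_congr rfl (fun s _ => h2 s), Finset.powerset_univ] at h
    rw [← h]
    split_ifs with hf
    · rw [Finset.prod_congr rfl (g := fun _ => (-1 : R))]
      · simp
      · intro i _
        simp [hf.2 i]
    · have hns : ¬ Function.Surjective f := fun hsu => hf (Finite.surjective_iff_bijective.1 hsu)
      rw [Function.Surjective] at hns
      push Not at hns
      obtain ⟨j, hj⟩ := hns
      apply Finset.prod_eq_zero (Finset.mem_univ j)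
      rw [if_neg]
      · simp
      · rintro ⟨i, hi⟩
        exact hj i hi
  have expand : ∀ s : Finset (Fin m), A (fun _ => ∑ i ∈ s, v i) =
      ∑ f : Fin m → Fin m, if ∀ i, f i ∈ s then A (v ∘ f) else 0 := by
    intro s
    rw [A.map_sum_finset (fun _ j => v j) (fun _ => s), ← Finset.sum_filter]
    apply Finset.sum_congr
    · ext f; simp [Fintype.mem_piFinset]
    · intros; rfl
  simp_rw [expand, Finset.smul_sum]
  rw [Finset.sum_comm]
  have h3 : ∀ f : Fin m → Fin m, ∑ s : Finset (Fin m),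
      (-1 : R) ^ s.card • (if ∀ i, f i ∈ s then A (v ∘ f) else 0) =
      if Function.Bijective f then (-1 : R) ^ m • A v else 0 := by
    intro f
    have : ∀ s : Finset (Fin m), (-1 : R) ^ s.card • (if ∀ i, f i ∈ s then A (v ∘ f) else 0) =
        (if ∀ i, f i ∈ s then (-1 : R) ^ s.card else 0) • A (v ∘ f) := by
      intro s; split_ifs <;> simp
    rw [Finset.sum_congr rfl (fun s _ => this s), ← Finset.sum_smul, key]
    split_ifs with hf
    · rw [← hsym v (Equiv.ofBijective f hf)]; rfl
    · simp
  rw [Finset.sum_congr rfl (fun f _ => h3 f), ← Finset.sum_filter, Finset.sum_const]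
  have hcard : (Finset.univ.filter fun f : Fin m → Fin m => Function.Bijective f).card =
      m.factorial := by
    rw [← Fintype.card_subtype, Fintype.card_congr (Equiv.ofBijective
      (fun σ : Equiv.Perm (Fin m) =>
        (⟨σ, σ.bijective⟩ : {f : Fin m → Fin m // Function.Bijective f}))
      ⟨fun σ τ h => Equiv.ext fun i => congrFun (congrArg Subtype.val h) i,
        fun f => ⟨Equiv.ofBijective f.1 f.2, rfl⟩⟩).symm, Fintype.card_perm, Fintype.card_fin]
  rw [hcard, ← Nat.cast_smul_eq_nsmul R, smul_smul, mul_comm]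

/-- If the values of a continuous `m`-homogeneous polynomial on the unit ball lie in the image of
the unit ball under an injective operator `θ`, then the polynomial factors through `θ`. -/
theorem exists_lift_polynomial {E F X : Type*} [NormedAddCommGroup E] [NormedSpace ℂ E]
    [NormedAddCommGroup F] [NormedSpace ℂ F] [SeminormedAddCommGroup X] [NormedSpace ℂ X] {m : ℕ}
    (A : ContinuousMultilinearMap ℂ (fun _ : Fin m => E) F)
    (hsym : ∀ (v : Fin m → E) (σ : Equiv.Perm (Fin m)), A (v ∘ σ) = A v)
    (θ : X →L[ℂ] F) (hθ : Function.Injective θ)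
    (h : ∀ x : E, ‖x‖ ≤ 1 → ∃ u : X, ‖u‖ ≤ 1 ∧ θ u = polyEval A x) :
    ∃ Q : ContinuousMultilinearMap ℂ (fun _ : Fin m => E) X,
      (∀ x, θ (polyEval Q x) = polyEval A x) ∧ ∀ x, ‖x‖ ≤ 1 → ‖polyEval Q x‖ ≤ 1 := by
  have hc : ((-1 : ℂ) ^ m * (m.factorial : ℂ)) ≠ 0 :=
    mul_ne_zero (pow_ne_zero _ (by norm_num)) (by exact_mod_cast m.factorial_ne_zero)
  have hnorm : ‖((-1 : ℂ) ^ m * (m.factorial : ℂ))‖ = m.factorial := by simp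
  have hhom : ∀ x : E, ∃ u : X, ‖u‖ ≤ ‖x‖ ^ m ∧ θ u = polyEval A x := by
    intro x
    rcases eq_or_ne x 0 with rfl | hx
    · rcases Nat.eq_zero_or_pos m with rfl | hm
      · simpa using h 0 (by simp)
      · refine ⟨0, by simp, ?_⟩
        rw [map_zero, polyEval]
        exact (A.map_coord_zero (⟨0, hm⟩ : Fin m) rfl).symm
    · have hx' : ‖x‖ ≠ 0 := norm_ne_zero_iff.2 hx
      obtain ⟨u, hu, hu'⟩ := h ((‖x‖ : ℂ)⁻¹ • x) (by simp [norm_smul, hx'])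
      refine ⟨(‖x‖ : ℂ) ^ m • u, ?_, ?_⟩
      · rw [norm_smul]
        simpa using mul_le_of_le_one_right (by positivity) hu
      · rw [map_smul, hu']
        have := A.map_smul_univ (fun _ : Fin m => (‖x‖ : ℂ)⁻¹) (fun _ => x)
        simp only [polyEval]
        rw [this, Finset.prod_const, Finset.card_univ, Fintype.card_fin, smul_smul, ← mul_pow,
          mul_inv_cancel₀ (by exact_mod_cast hx'), one_pow, one_smul]
  have hrange : ∀ v : Fin m → E, ∃ u : X, θ u = A v ∧
      ((∀ i, ‖v i‖ ≤ 1) → ‖u‖ ≤ (Finset.univ : Finset (Finset (Fin m))).card * (m : ℝ) ^ m) := by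
    intro v
    choose g hg hg' using fun s : Finset (Fin m) => hhom (∑ i ∈ s, v i)
    have hpol := A.toMultilinearMap.sum_powerset_polarization hsym v
    refine ⟨((-1 : ℂ) ^ m * (m.factorial : ℂ))⁻¹ •
      ∑ s : Finset (Fin m), (-1 : ℂ) ^ s.card • g s, ?_, ?_⟩
    · rw [map_smul, map_sum, inv_smul_eq_iff₀ hc]
      refine Eq.trans ?_ hpol
      exact Finset.sum_congr rfl fun s _ => by rw [map_smul, hg']; rfl
    · intro hv
      rw [norm_smul, norm_inv, hnorm]
      have h1 : ‖∑ s : Finset (Fin m), (-1 : ℂ) ^ s.card • g s‖ ≤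
          (Finset.univ : Finset (Finset (Fin m))).card * (m : ℝ) ^ m := by
        rw [← nsmul_eq_mul]
        refine norm_sum_le_of_le _ (fun s _ => ?_) |>.trans (Finset.sum_const _).le
        rw [norm_smul]
        have : ‖∑ i ∈ s, v i‖ ≤ m := by
          refine (norm_sum_le_of_le s (fun i _ => hv i)).trans ?_
          simpa using Finset.card_le_univ s
        simpa using (hg s).trans (pow_le_pow_left₀ (norm_nonneg _) this m)
      refine (mul_le_of_le_one_left (norm_nonneg _) ?_).trans h1
      exact inv_le_one_of_one_le₀ (by exact_mod_cast m.factorial_pos)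
  choose q hq hq' using hrange
  let B : MultilinearMap ℂ (fun _ : Fin m => E) X :=
    { toFun := q
      map_update_add' := by
        intro _ v i x y
        apply hθ
        rw [map_add, hq, hq, hq]
        convert A.map_update_add v i x y
      map_update_smul' := by
        intro _ v i c x
        apply hθ
        rw [map_smul, hq, hq]
        convert A.map_update_smul v i c x }
  have hB : ∀ v, ‖B v‖ ≤ ((Finset.univ : Finset (Finset (Fin m))).card * (m : ℝ) ^ m) *
      ∏ i, ‖v i‖ := by
    intro v
    by_cases hv : ∃ i, v i = 0
    · obtain ⟨i, hi⟩ := hv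
      rw [B.map_coord_zero i hi, norm_zero]
      positivity
    · push Not at hv
      have hv' : v = fun i => (‖v i‖ : ℂ) • ((‖v i‖ : ℂ)⁻¹ • v i) := by
        ext i
        rw [smul_inv_smul₀]
        exact_mod_cast norm_ne_zero_iff.2 (hv i)
      have h1 : B v = (∏ i, (‖v i‖ : ℂ)) • B (fun i => (‖v i‖ : ℂ)⁻¹ • v i) := by
        conv_lhs => rw [hv']
        exact B.map_smul_univ _ _
      rw [h1, norm_smul, norm_prod, mul_comm]
      simp only [Complex.norm_real, norm_norm]
      refine mul_le_mul_of_nonneg_right (hq' _ fun i => ?_) (by positivity)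
      simp [norm_smul, hv i]
  refine ⟨B.mkContinuous _ hB, fun x => hq _, fun x hx => ?_⟩
  obtain ⟨u, hu, hu'⟩ := h x hx
  have : polyEval (B.mkContinuous _ hB) x = u := hθ ((hq _).trans hu'.symm)
  rwa [this]

/-! ### Weights -/

/-- A summable nonnegative series stays summable, with almost the same sum, after multiplication by
suitable weights tending to infinity. -/
theorem exists_weights {a : ℕ → ℝ} (ha : ∀ n, 0 ≤ a n) (hs : Summable a) {ε : ℝ} (hε : 0 < ε) :
    ∃ μ : ℕ → ℝ, (∀ n, 1 ≤ μ n) ∧ Tendsto μ atTop atTop ∧ (Summable fun n => a n * μ n) ∧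
      ∑' n, a n * μ n ≤ ∑' n, a n + ε := by
  let b : ℕ → ℝ := fun n => a n + (1 / 2) ^ n
  have hb : Summable b := hs.add summable_geometric_two
  have hbpos : ∀ n, 0 < b n := fun n => add_pos_of_nonneg_of_pos (ha n) (by positivity)
  let t : ℕ → ℝ := fun n => ∑' k, b (k + n)
  have ht : ∀ n, t n = b n + t (n + 1) := by
    intro n
    have := ((summable_nat_add_iff n).2 hb).tsum_eq_zero_add
    simp only [zero_add] at this
    change ∑' k, b (k + n) = b n + ∑' k, b (k + (n + 1))
    rw [this]
    simp only [add_assoc, add_comm 1 n]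
  have htpos : ∀ n, 0 < t n := fun n =>
    ((summable_nat_add_iff n).2 hb).tsum_pos (fun k => (hbpos _).le) 0 (hbpos _)
  have ht0 : Tendsto t atTop (𝓝 0) := tendsto_sum_nat_add b
  let c : ℝ := ε / (2 * √(t 0))
  have hc : 0 < c := div_pos hε (by have := Real.sqrt_pos.2 (htpos 0); positivity)
  have hstep : ∀ n, a n * (c / √(t n)) ≤ 2 * c * √(t n) - 2 * c * √(t (n + 1)) := by
    intro n
    have h0 := Real.sqrt_pos.2 (htpos n)
    have h1 := Real.sqrt_pos.2 (htpos (n + 1))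
    have e0 := Real.sq_sqrt (htpos n).le
    have e1 := Real.sq_sqrt (htpos (n + 1)).le
    have hab : a n ≤ t n - t (n + 1) := by
      rw [ht n]
      have : (0 : ℝ) < (1 / 2) ^ n := by positivity
      simp only [b]; linarith
    have : a n * (c / √(t n)) = c * a n / √(t n) := by ring
    rw [this, div_le_iff₀ h0]
    have : a n ≤ (√(t n) - √(t (n + 1))) * 2 * √(t n) := by
      nlinarith [sq_nonneg (√(t n) - √(t (n + 1)))]
    calc c * a n ≤ c * ((√(t n) - √(t (n + 1))) * 2 * √(t n)) := by gcongr
      _ = _ := by ring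
  have hpart : ∀ N, ∑ n ∈ Finset.range N, a n * (c / √(t n)) ≤ ε := by
    intro N
    refine (Finset.sum_le_sum fun n _ => hstep n).trans ?_
    rw [Finset.sum_range_sub']
    have h0 := Real.sqrt_pos.2 (htpos 0)
    have : 2 * c * √(t 0) = ε := by simp only [c]; field_simp
    have : 0 ≤ 2 * c * √(t N) := by positivity
    linarith
  have hnn : ∀ n, 0 ≤ a n * (c / √(t n)) := fun n =>
    mul_nonneg (ha n) (div_nonneg hc.le (Real.sqrt_nonneg _))
  have hsum : Summable fun n => a n * (c / √(t n)) := summable_of_sum_range_le hnn hpart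
  refine ⟨fun n => 1 + c / √(t n), fun n => ?_, ?_, ?_, ?_⟩
  · have : 0 ≤ c / √(t n) := div_nonneg hc.le (Real.sqrt_nonneg _)
    linarith
  · apply tendsto_atTop_add_const_left
    have h1 : Tendsto (fun n => √(t n)) atTop (𝓝[>] 0) := by
      refine tendsto_nhdsWithin_iff.2 ⟨?_, Eventually.of_forall fun n => Real.sqrt_pos.2 (htpos n)⟩
      simpa using ht0.sqrt
    simpa [div_eq_mul_inv] using (h1.inv_tendsto_nhdsGT_zero).const_mul_atTop hc
  · simpa only [mul_add, mul_one] using hs.add hsum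
  · simp only [mul_add, mul_one]
    rw [hs.tsum_add hsum]
    have := Real.tsum_le_of_sum_range_le hnn hpart
    linarith

/-! ### Operators into and out of `ℓ₁` -/

theorem ConjUnitBall.summable_mul {p : ℝ} (hp : 1 ≤ p) {α : ℕ → ℂ} (hα : ConjUnitBall p α)
    {w : ℕ → ℝ} (hw0 : ∀ n, 0 ≤ w n) (hw : Summable fun n => w n ^ p) :
    (Summable fun n => ‖α n‖ * w n) ∧ ∑' n, ‖α n‖ * w n ≤ (∑' n, w n ^ p) ^ (1 / p) := by
  rcases hp.eq_or_lt with rfl | hp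
  · simp only [ConjUnitBall, if_true] at hα
    simp only [Real.rpow_one, one_div, inv_one] at hw ⊢
    have hle : ∀ n, ‖α n‖ * w n ≤ w n := fun n => mul_le_of_le_one_left (hw0 n) (hα n)
    have hs : Summable fun n => ‖α n‖ * w n :=
      hw.of_nonneg_of_le (fun n => mul_nonneg (norm_nonneg _) (hw0 n)) hle
    exact ⟨hs, hs.tsum_le_tsum hle hw⟩
  · rw [ConjUnitBall, if_neg hp.ne'] at hα
    have hpq : (p / (p - 1)).HolderConjugate p := (Real.HolderConjugate.conjExponent hp).symm
    obtain ⟨h1, h2⟩ := Real.summable_and_inner_le_Lp_mul_Lq_tsum_of_nonneg hpq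
      (fun n => norm_nonneg (α n)) hw0 hα.1 hw
    refine ⟨h1, h2.trans (mul_le_of_le_one_left ?_ ?_)⟩
    · exact Real.rpow_nonneg (tsum_nonneg fun n => Real.rpow_nonneg (hw0 n) _) _
    · exact Real.rpow_le_one (tsum_nonneg fun n => Real.rpow_nonneg (norm_nonneg _) _) hα.2
        (one_div_nonneg.2 hpq.nonneg)

theorem lp_one_norm_eq_tsum (a : lp (fun _ : ℕ => ℂ) 1) :
    (Summable fun n => ‖a n‖) ∧ ‖a‖ = ∑' n, ‖a n‖ := by
  have h := lp.hasSum_norm (p := 1) (by simp) a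
  simp only [ENNReal.toReal_one, Real.rpow_one] at h
  exact ⟨h.summable, h.tsum_eq.symm⟩

/-- The diagonal operator `d ↦ (w n * c n d)` into `ℓ₁`. -/
theorem exists_diagonal_operator {D : Type*} [SeminormedAddCommGroup D] [NormedSpace ℂ D] {p : ℝ}
    (hp : 1 ≤ p) (c : ℕ → D →ₗ[ℂ] ℂ) (hc : ∀ d : D, ‖d‖ ≤ 1 → ConjUnitBall p fun n => c n d)
    {w : ℕ → ℝ} (hw0 : ∀ n, 0 ≤ w n) (hw : Summable fun n => w n ^ p) :
    ∃ R : D →L[ℂ] lp (fun _ : ℕ => ℂ) 1, ∀ d n, R d n = c n d * w n := by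
  have hball : ∀ d : D, ‖d‖ ≤ 1 → Summable fun n => ‖c n d * w n‖ := fun d hd => by
    simpa [abs_of_nonneg (hw0 _)] using ((hc d hd).summable_mul hp hw0 hw).1
  have hscale : ∀ (d : D) (δ : ℝ), 0 < δ → ‖((‖d‖ + δ : ℝ) : ℂ)⁻¹ • d‖ ≤ 1 := fun d δ hδ => by
    have hpos : 0 < ‖d‖ + δ := by positivity
    rw [norm_smul, norm_inv, Complex.norm_real, Real.norm_of_nonneg hpos.le,
      inv_mul_le_iff₀ hpos]
    linarith
  have hmem : ∀ d : D, Memℓp (fun n => c n d * w n) 1 := fun d => by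
    refine memℓp_gen ?_
    simp only [ENNReal.toReal_one, Real.rpow_one]
    have hpos : 0 < ‖d‖ + 1 := by positivity
    have := (hball _ (hscale d 1 one_pos)).mul_left (‖d‖ + 1)
    refine this.congr fun n => ?_
    rw [map_smul, smul_eq_mul, mul_assoc, norm_mul (_⁻¹), norm_inv, Complex.norm_real,
      Real.norm_of_nonneg hpos.le, mul_inv_cancel_left₀ hpos.ne']
  let R : D →ₗ[ℂ] lp (fun _ : ℕ => ℂ) 1 :=
    { toFun := fun d => ⟨fun n => c n d * w n, hmem d⟩
      map_add' := fun d e => by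
        ext n
        exact (congrArg (· * (w n : ℂ)) ((c n).map_add d e)).trans (add_mul _ _ _)
      map_smul' := fun k d => by
        ext n
        simp [mul_assoc] }
  have hR : ∀ d n, R d n = c n d * w n := fun d n => rfl
  refine ⟨⟨R, ?_⟩, hR⟩
  have hbound : ∀ d : D, ‖d‖ ≤ 1 → ‖R d‖ ≤ (∑' n, w n ^ p) ^ (1 / p) := fun d hd => by
    rw [(lp_one_norm_eq_tsum _).2]
    simpa [hR, abs_of_nonneg (hw0 _)] using ((hc d hd).summable_mul hp hw0 hw).2
  refine AddMonoidHomClass.continuous_of_bound R ((∑' n, w n ^ p) ^ (1 / p)) fun d => ?_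
  have hC : 0 ≤ (∑' n, w n ^ p) ^ (1 / p) := (norm_nonneg _).trans (hbound 0 (by simp))
  refine ge_of_tendsto (x := 𝓝[>] (0 : ℝ)) (f := fun δ => (∑' n, w n ^ p) ^ (1 / p) * (‖d‖ + δ))
    ?_ ?_
  · refine Tendsto.mono_left ?_ nhdsWithin_le_nhds
    have : Continuous fun δ : ℝ => (∑' n, w n ^ p) ^ (1 / p) * (‖d‖ + δ) := by fun_prop
    simpa using this.tendsto 0
  · filter_upwards [self_mem_nhdsWithin] with δ hδ
    have hpos : 0 < ‖d‖ + δ := add_pos_of_nonneg_of_pos (norm_nonneg _) hδ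
    have := hbound _ (hscale d δ hδ)
    rwa [map_smul, norm_smul, norm_inv, Complex.norm_real, Real.norm_of_nonneg hpos.le,
      inv_mul_le_iff₀ hpos, mul_comm] at this

/-- The operator `ℓ₁ → F` sending the unit vectors to a null sequence in the unit ball is a compact
contraction. -/
theorem exists_compact_operator_lp_one {F : Type*} [NormedAddCommGroup F] [NormedSpace ℂ F]
    [CompleteSpace F] {s : ℕ → F} (hs1 : ∀ n, ‖s n‖ ≤ 1) (hs : Tendsto s atTop (𝓝 0)) :
    ∃ S : lp (fun _ : ℕ => ℂ) 1 →L[ℂ] F, (∀ a, HasSum (fun n => a n • s n) (S a)) ∧ ‖S‖ ≤ 1 ∧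
      IsCompactOperator S := by
  have key : ∀ (C : ℝ) (s : ℕ → F), 0 ≤ C → (∀ n, ‖s n‖ ≤ C) →
      ∃ S : lp (fun _ : ℕ => ℂ) 1 →L[ℂ] F, (∀ a, HasSum (fun n => a n • s n) (S a)) ∧ ‖S‖ ≤ C := by
    intro C s hC hs
    have hle : ∀ (a : lp (fun _ : ℕ => ℂ) 1) n, ‖a n • s n‖ ≤ ‖a n‖ * C := fun a n => by
      rw [norm_smul]; exact mul_le_mul_of_nonneg_left (hs n) (norm_nonneg _)
    have hsum : ∀ a : lp (fun _ : ℕ => ℂ) 1, Summable fun n => a n • s n := fun a =>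
      Summable.of_norm_bounded ((lp_one_norm_eq_tsum a).1.mul_right C) (hle a)
    let S : lp (fun _ : ℕ => ℂ) 1 →ₗ[ℂ] F :=
      { toFun := fun a => ∑' n, a n • s n
        map_add' := fun a b => by
          rw [← (hsum a).tsum_add (hsum b)]
          exact tsum_congr fun n => by simp [add_smul]
        map_smul' := fun k a => by
          rw [RingHom.id_apply, ← (hsum a).tsum_const_smul k]
          exact tsum_congr fun n => by simp [mul_smul] }
    have hb : ∀ a, ‖S a‖ ≤ C * ‖a‖ := fun a => by
      rw [(lp_one_norm_eq_tsum a).2, mul_comm, ← tsum_mul_right]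
      exact tsum_of_norm_bounded ((lp_one_norm_eq_tsum a).1.mul_right C).hasSum (hle a)
    exact ⟨S.mkContinuous C hb, fun a => (hsum a).hasSum, S.mkContinuous_norm_le hC hb⟩
  obtain ⟨S, hS, hS1⟩ := key 1 s zero_le_one hs1
  refine ⟨S, hS, hS1, ?_⟩
  let T : ℕ → (lp (fun _ : ℕ => ℂ) 1 →L[ℂ] F) := fun k =>
    ∑ n ∈ Finset.range k, (lp.evalCLM ℂ (fun _ : ℕ => ℂ) 1 n).smulRight (s n)
  have hT : ∀ k a, T k a = ∑ n ∈ Finset.range k, a n • s n := fun k a => by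
    simp [T, lp.evalCLM]
  have hTcompact : ∀ k, IsCompactOperator (T k) := fun k => by
    have : T k ∈ compactOperator (RingHom.id ℂ) (lp (fun _ : ℕ => ℂ) 1) F := by
      refine Submodule.sum_mem _ fun n _ => ?_
      exact (isCompactOperator_of_locallyCompactSpace_rng
        (ContinuousLinearMap.toSpanSingleton ℂ (s n))).comp_clm
          (lp.evalCLM ℂ (fun _ : ℕ => ℂ) 1 n)
    exact this
  refine isCompactOperator_of_tendsto (l := atTop) (F := T) ?_ (Eventually.of_forall hTcompact)
  rw [Metric.tendsto_atTop]
  intro ε hε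
  obtain ⟨K, hK⟩ := Metric.tendsto_atTop.1 hs (ε / 2) (by positivity)
  refine ⟨K, fun k hk => ?_⟩
  obtain ⟨U, hU, hU'⟩ := key (ε / 2) (fun n => if n < k then 0 else s n) (by positivity)
    (fun n => by
      split_ifs with h
      · simp; positivity
      · simpa using (hK n (by omega)).le)
  have hSU : S - T k = U := by
    ext1 a
    refine HasSum.unique ?_ (hU a)
    have h1 : HasSum (fun n => if n < k then a n • s n else 0) (T k a) := by
      rw [hT]
      rw [Finset.sum_congr rfl fun n hn =>
        (if_pos (Finset.mem_range.1 hn) : (if n < k then a n • s n else 0) = _).symm]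
      exact hasSum_sum_of_ne_finset_zero fun n hn => if_neg (Finset.mem_range.not.1 hn)
    refine ((hS a).sub h1).congr_fun fun n => ?_
    split_ifs <;> simp
  rw [dist_comm, dist_eq_norm, hSU]
  linarith

/-! ### The factorization -/

theorem supNorm_nonneg {E F : Type*} [SeminormedAddCommGroup E] [SeminormedAddCommGroup F]
    (P : E → F) : 0 ≤ supNorm P :=
  Real.sSup_nonneg (by rintro _ ⟨x, -, rfl⟩; exact norm_nonneg _)

theorem supNorm_le {E F : Type*} [SeminormedAddCommGroup E] [SeminormedAddCommGroup F]
    {P : E → F} {C : ℝ} (hC : 0 ≤ C) (h : ∀ x, ‖x‖ ≤ 1 → ‖P x‖ ≤ C) : supNorm P ≤ C :=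
  Real.sSup_le (by rintro _ ⟨x, hx, rfl⟩; exact h x (mem_closedBall_zero_iff.1 hx)) hC

theorem norm_polyEval_le_supNorm {E F : Type*} [SeminormedAddCommGroup E] [NormedSpace ℂ E]
    [SeminormedAddCommGroup F] [NormedSpace ℂ F] {m : ℕ}
    (Q : ContinuousMultilinearMap ℂ (fun _ : Fin m => E) F) {x : E} (hx : ‖x‖ ≤ 1) :
    ‖polyEval Q x‖ ≤ supNorm (polyEval Q) := by
  refine le_csSup ⟨‖Q‖, ?_⟩ ⟨x, mem_closedBall_zero_iff.2 hx, rfl⟩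
  rintro _ ⟨y, hy, rfl⟩
  refine (Q.le_opNorm _).trans (mul_le_of_le_one_right (norm_nonneg _) ?_)
  exact Finset.prod_le_one (fun _ _ => norm_nonneg _) fun _ _ => mem_closedBall_zero_iff.1 hy

theorem mP_nonneg {F : Type*} [SeminormedAddCommGroup F] [NormedSpace ℂ F] (p : ℝ) (K : Set F) :
    0 ≤ mP p K := by
  refine Real.sInf_nonneg ?_
  rintro _ ⟨x, -, -, rfl⟩
  exact Real.rpow_nonneg (tsum_nonneg fun n => Real.rpow_nonneg (norm_nonneg _) _) _

theorem mP_le {F : Type*} [SeminormedAddCommGroup F] [NormedSpace ℂ F] {p : ℝ} {K : Set F}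
    {x : ℕ → F} (hx : Summable fun n => ‖x n‖ ^ p) (hK : K ⊆ pCo p x) :
    mP p K ≤ (∑' n, ‖x n‖ ^ p) ^ (1 / p) := by
  refine csInf_le ⟨0, ?_⟩ ⟨x, hx, hK, rfl⟩
  rintro _ ⟨x, -, -, rfl⟩
  exact Real.rpow_nonneg (tsum_nonneg fun n => Real.rpow_nonneg (norm_nonneg _) _) _

/-- The `p`-norm of a rescaled sequence. -/
theorem summable_and_tsum_const_mul_rpow {p : ℝ} (hp : 1 ≤ p) {a b : ℕ → ℝ} (hb : ∀ n, 0 ≤ b n)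
    (hs : Summable fun n => b n ^ p) {C : ℝ} (hC : 0 ≤ C) (ha : ∀ n, 0 ≤ a n)
    (hab : ∀ n, a n ≤ C * b n) :
    (Summable fun n => a n ^ p) ∧
      (∑' n, a n ^ p) ^ (1 / p) ≤ C * (∑' n, b n ^ p) ^ (1 / p) := by
  have hp0 : 0 < p := by linarith
  have hle : ∀ n, a n ^ p ≤ C ^ p * b n ^ p := fun n => by
    rw [← Real.mul_rpow hC (hb n)]
    exact Real.rpow_le_rpow (ha n) (hab n) hp0.le
  have hsum : Summable fun n => a n ^ p :=
    (hs.mul_left (C ^ p)).of_nonneg_of_le (fun n => Real.rpow_nonneg (ha n) _) hle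
  refine ⟨hsum, ?_⟩
  have h1 : ∑' n, a n ^ p ≤ C ^ p * ∑' n, b n ^ p := by
    rw [← tsum_mul_left]
    exact hsum.tsum_le_tsum hle (hs.mul_left _)
  calc (∑' n, a n ^ p) ^ (1 / p) ≤ (C ^ p * ∑' n, b n ^ p) ^ (1 / p) :=
        Real.rpow_le_rpow (tsum_nonneg fun n => Real.rpow_nonneg (ha n) _) h1 (by positivity)
    _ = C * (∑' n, b n ^ p) ^ (1 / p) := by
        rw [Real.mul_rpow (by positivity) (tsum_nonneg fun n => Real.rpow_nonneg (hb n) _),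
          ← Real.rpow_mul hC, mul_one_div_cancel hp0.ne', Real.rpow_one]

theorem exists_mem_ball_mk_eq {D : Type*} [SeminormedAddCommGroup D] [NormedSpace ℂ D]
    {N : Submodule ℂ D} {u : D ⧸ N} (hu : ‖u‖ ≤ 1) {ε : ℝ} (hε : 0 < ε) :
    ∃ d : D, ‖d‖ ≤ 1 ∧ ((1 + ε : ℝ) : ℂ) • N.mkQ d = u := by
  have hpos : 0 < 1 + ε := by linarith
  obtain ⟨d, rfl, hd⟩ := Submodule.Quotient.norm_mk_lt u hε
  refine ⟨((1 + ε : ℝ) : ℂ)⁻¹ • d, ?_, ?_⟩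
  · rw [norm_smul, norm_inv, Complex.norm_real, Real.norm_of_nonneg hpos.le, inv_mul_le_iff₀ hpos]
    linarith
  · rw [map_smul, smul_inv_smul₀ (by exact_mod_cast hpos.ne')]
    rfl

/-- Image of the unit ball under an operator on a quotient of `D` that is diagonal on `D`. -/
theorem isRelPCompact_and_mP_le_of_hasSum {D G : Type*} [SeminormedAddCommGroup D]
    [NormedSpace ℂ D] [SeminormedAddCommGroup G] [NormedSpace ℂ G] {p : ℝ} (hp : 1 ≤ p)
    (c : ℕ → D →ₗ[ℂ] ℂ) (hc : ∀ d : D, ‖d‖ ≤ 1 → ConjUnitBall p fun n => c n d)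
    {N : Submodule ℂ D} (R : (D ⧸ N) →L[ℂ] G) {g : ℕ → G} {w : ℕ → ℝ} (hg : ∀ n, ‖g n‖ ≤ w n)
    (hw : Summable fun n => w n ^ p) (hR : ∀ d, HasSum (fun n => c n d • g n) (R (N.mkQ d))) :
    IsRelPCompact p (⇑R '' closedBall 0 1) ∧
      mP p (⇑R '' closedBall 0 1) ≤ (∑' n, w n ^ p) ^ (1 / p) := by
  have hw0 : ∀ n, 0 ≤ w n := fun n => (norm_nonneg _).trans (hg n)
  have key : ∀ ε : ℝ, 0 < ε → ∃ x : ℕ → G, (Summable fun n => ‖x n‖ ^ p) ∧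
      ⇑R '' closedBall 0 1 ⊆ pCo p x ∧
      (∑' n, ‖x n‖ ^ p) ^ (1 / p) ≤ (1 + ε) * (∑' n, w n ^ p) ^ (1 / p) := by
    intro ε hε
    have hpos : 0 < 1 + ε := by linarith
    obtain ⟨h1, h2⟩ := summable_and_tsum_const_mul_rpow hp hw0 hw hpos.le
      (a := fun n => ‖((1 + ε : ℝ) : ℂ) • g n‖) (fun n => norm_nonneg _) (fun n => by
        rw [norm_smul, Complex.norm_real, Real.norm_of_nonneg hpos.le]
        exact mul_le_mul_of_nonneg_left (hg n) hpos.le)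
    refine ⟨_, h1, ?_, h2⟩
    rintro _ ⟨u, hu, rfl⟩
    obtain ⟨d, hd, rfl⟩ := exists_mem_ball_mk_eq (mem_closedBall_zero_iff.1 hu) hε
    refine ⟨fun n => c n d, hc d hd, ?_⟩
    rw [map_smul]
    exact ((hR d).const_smul ((1 + ε : ℝ) : ℂ)).congr_fun fun n => smul_comm _ _ _
  constructor
  · obtain ⟨x, hx, hx', -⟩ := key 1 one_pos
    exact ⟨x, hx, hx'⟩
  · refine ge_of_tendsto (x := 𝓝[>] (0 : ℝ))
      (f := fun ε => (1 + ε) * (∑' n, w n ^ p) ^ (1 / p)) ?_ ?_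
    · refine Tendsto.mono_left ?_ nhdsWithin_le_nhds
      have : Continuous fun ε : ℝ => (1 + ε) * (∑' n, w n ^ p) ^ (1 / p) := by fun_prop
      simpa using this.tendsto 0
    · filter_upwards [self_mem_nhdsWithin] with ε hε
      obtain ⟨x, hx, hx', hle⟩ := key ε hε
      exact (mP_le hx hx').trans hle

theorem exists_factorNorm_le {E F D : Type*}
    [NormedAddCommGroup E] [NormedSpace ℂ E] [NormedAddCommGroup F] [NormedSpace ℂ F]
    [CompleteSpace F] [SeminormedAddCommGroup D] [NormedSpace ℂ D] {p : ℝ} (hp : 1 ≤ p) {m : ℕ}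
    (A : ContinuousMultilinearMap ℂ (fun _ : Fin m => E) F)
    (hsym : ∀ (v : Fin m → E) (σ : Equiv.Perm (Fin m)), A (v ∘ σ) = A v)
    (c : ℕ → D →ₗ[ℂ] ℂ) (hc : ∀ d : D, ‖d‖ ≤ 1 → ConjUnitBall p fun n => c n d)
    (hc' : ∀ (α : ℕ → ℂ) (β : ℕ → ℝ), ConjUnitBall p α → (∀ n, 0 ≤ β n) → (∀ n, β n ≤ 1) →
      Tendsto β atTop (𝓝 0) → ∃ d : D, ‖d‖ ≤ 1 ∧ ∀ n, c n d = β n * α n)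
    {x : ℕ → F} (hx : Summable fun n => ‖x n‖ ^ p)
    (hK : polyEval A '' closedBall 0 1 ⊆ pCo p x) {ε : ℝ} (hε : 0 < ε) :
    ∃ r ∈ FactorNormsViaL1 p A D, r ≤ (∑' n, ‖x n‖ ^ p + ε) ^ (1 / p) := by
  have hp0 : 0 < p := by linarith
  obtain ⟨μ, hμ1, hμ, hμs, hμle⟩ :=
    exists_weights (fun n => Real.rpow_nonneg (norm_nonneg (x n)) p) hx hε
  let l : ℕ → ℝ := fun n => μ n ^ (1 / (2 * p))
  have hl1 : ∀ n, 1 ≤ l n := fun n => Real.one_le_rpow (hμ1 n) (by positivity)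
  have hl0 : ∀ n, 0 < l n := fun n => one_pos.trans_le (hl1 n)
  have hl : Tendsto l atTop atTop := (tendsto_rpow_atTop (by positivity)).comp hμ
  have hlinv : Tendsto (fun n => (l n)⁻¹) atTop (𝓝 0) := tendsto_inv_atTop_zero.comp hl
  let w : ℕ → ℝ := fun n => l n ^ 2 * ‖x n‖
  have hw0 : ∀ n, 0 ≤ w n := fun n => by positivity
  have hwp : ∀ n, w n ^ p = ‖x n‖ ^ p * μ n := fun n => by
    have hμ0 : 0 ≤ μ n := zero_le_one.trans (hμ1 n)
    simp only [w, l]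
    rw [Real.mul_rpow (by positivity) (norm_nonneg _), ← Real.rpow_natCast, ← Real.rpow_mul hμ0,
      ← Real.rpow_mul hμ0, mul_comm]
    congr 1
    convert Real.rpow_one (μ n) using 2
    push_cast
    field_simp
  have hw : Summable fun n => w n ^ p := by simpa only [hwp] using hμs
  have hwle : ∑' n, w n ^ p ≤ ∑' n, ‖x n‖ ^ p + ε := by simpa only [hwp] using hμle
  let s : ℕ → F := fun n => ((l n * ‖x n‖ : ℝ) : ℂ)⁻¹ • x n
  have hsnorm : ∀ n, ‖s n‖ ≤ (l n)⁻¹ := fun n => by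
    simp only [s]
    rw [norm_smul, norm_inv, Complex.norm_real, norm_mul, norm_norm,
      Real.norm_of_nonneg (hl0 n).le, mul_inv, mul_assoc]
    exact mul_le_of_le_one_right (inv_nonneg.2 (hl0 n).le) inv_mul_le_one
  have hs1 : ∀ n, ‖s n‖ ≤ 1 := fun n => (hsnorm n).trans (inv_le_one_of_one_le₀ (hl1 n))
  have hs : Tendsto s atTop (𝓝 0) := squeeze_zero_norm hsnorm hlinv
  have hws : ∀ n, (w n : ℂ) • s n = (l n : ℂ) • x n := fun n => by
    rcases eq_or_ne (x n) 0 with h | h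
    · simp [s, h]
    · have h1 : (‖x n‖ : ℂ) ≠ 0 := by exact_mod_cast norm_ne_zero_iff.2 h
      have h2 : (l n : ℂ) ≠ 0 := by exact_mod_cast (hl0 n).ne'
      simp only [s, w]
      rw [smul_smul]
      congr 1
      push_cast
      field_simp
  obtain ⟨R₀, hR₀⟩ := exists_diagonal_operator hp c hc hw0 hw
  obtain ⟨S₀, hS₀, hS₀1, hS₀c⟩ := exists_compact_operator_lp_one hs1 hs
  let M : Submodule ℂ (lp (fun _ : ℕ => ℂ) 1) := S₀.ker
  let N : Submodule ℂ D := (S₀ ∘L R₀).ker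
  have hM : IsClosed (M : Set (lp (fun _ : ℕ => ℂ) 1)) := S₀.isClosed_ker
  have hN : IsClosed (N : Set D) := (S₀ ∘L R₀).isClosed_ker
  let S : ((lp (fun _ : ℕ => ℂ) 1) ⧸ M) →L[ℂ] F := M.liftQL S₀ le_rfl
  have hSmk : ∀ a, S (M.mkQ a) = S₀ a := fun a => rfl
  have hNR : N ≤ (M.mkQL ∘L R₀).ker := fun d hd => by
    have : R₀ d ∈ M := hd
    exact (Submodule.Quotient.mk_eq_zero M).2 this
  let R : (D ⧸ N) →L[ℂ] ((lp (fun _ : ℕ => ℂ) 1) ⧸ M) := N.liftQL (M.mkQL ∘L R₀) hNR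
  have hRmk : ∀ d, R (N.mkQ d) = M.mkQ (R₀ d) := fun d => rfl
  have hinj : Function.Injective (S ∘L R) := by
    rw [injective_iff_map_eq_zero]
    intro u hu
    obtain ⟨d, rfl⟩ := N.mkQ_surjective u
    exact (Submodule.Quotient.mk_eq_zero N).2 hu
  obtain ⟨Q, hQ, hQ1⟩ := exists_lift_polynomial A hsym (S ∘L R) hinj fun y hy => by
    obtain ⟨α, hα, hαsum⟩ := hK ⟨y, mem_closedBall_zero_iff.2 hy, rfl⟩
    obtain ⟨d, hd, hd'⟩ := hc' α (fun n => (l n)⁻¹) hα (fun n => inv_nonneg.2 (hl0 n).le)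
      (fun n => inv_le_one_of_one_le₀ (hl1 n)) hlinv
    refine ⟨N.mkQ d, (Submodule.Quotient.norm_mk_le N d).trans hd, ?_⟩
    refine HasSum.unique (f := fun n => R₀ d n • s n) (hS₀ (R₀ d)) ?_
    refine hαsum.congr_fun fun n => ?_
    have h2 : (l n : ℂ) ≠ 0 := by exact_mod_cast (hl0 n).ne'
    rw [hR₀, mul_smul, hws, hd', smul_smul]
    congr 1
    push_cast
    field_simp
  have hSnorm : ‖S‖ ≤ 1 := by
    refine S.opNorm_le_bound zero_le_one fun u => ?_
    rw [one_mul]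
    refine le_of_forall_pos_le_add fun δ hδ => ?_
    obtain ⟨a, rfl, ha⟩ := Submodule.Quotient.norm_mk_lt u hδ
    refine le_trans ?_ ha.le
    exact (S₀.le_opNorm a).trans (mul_le_of_le_one_left (norm_nonneg _) hS₀1)
  have hScompact : IsCompactOperator S := by
    obtain ⟨K, hKc, hK⟩ := hS₀c
    refine ⟨K, hKc, ?_⟩
    have := M.isOpenQuotientMap_mkQL.isOpenMap.image_mem_nhds hK
    rw [map_zero] at this
    refine mem_of_superset this ?_
    rintro _ ⟨a, ha, rfl⟩
    exact ha
  obtain ⟨hRc, hRle⟩ := isRelPCompact_and_mP_le_of_hasSum hp c hc R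
    (g := fun n => M.mkQ (lp.single 1 n (w n : ℂ))) (w := w) (fun n => by
      refine (Submodule.Quotient.norm_mk_le M _).trans ?_
      rw [lp.norm_single one_pos, Complex.norm_real, Real.norm_of_nonneg (hw0 n)]) hw (fun d => by
      rw [hRmk]
      refine (M.mkQL.hasSum (lp.hasSum_single (by simp) (R₀ d))).congr_fun fun n => ?_
      change _ = M.mkQ _
      rw [hR₀, ← map_smul, ← lp.single_smul]
      rfl)
  refine ⟨_, ⟨N, hN, Q, M, hM, R, S, hRc, ?_, fun y => (hQ y).symm, rfl⟩, ?_⟩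
  · exact hScompact.isCompact_closure_image_closedBall (f := S.toLinearMap) 1
  · have hT : (∑' n, w n ^ p) ^ (1 / p) ≤ (∑' n, ‖x n‖ ^ p + ε) ^ (1 / p) :=
      Real.rpow_le_rpow (tsum_nonneg fun n => Real.rpow_nonneg (hw0 n) _) hwle (by positivity)
    have hQ' : supNorm (polyEval Q) ≤ 1 := supNorm_le zero_le_one hQ1
    have hnn := mP_nonneg p (⇑R '' closedBall 0 1)
    calc supNorm (polyEval Q) * mP p (⇑R '' closedBall 0 1) * ‖S‖
        ≤ 1 * mP p (⇑R '' closedBall 0 1) * 1 := by gcongr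
      _ ≤ _ := by linarith

theorem isRelPCompact_and_mP_le_of_mem_factorNorms {E F D : Type*}
    [SeminormedAddCommGroup E] [NormedSpace ℂ E] [NormedAddCommGroup F] [NormedSpace ℂ F]
    [SeminormedAddCommGroup D] [NormedSpace ℂ D] {p : ℝ} (hp : 1 ≤ p) {m : ℕ}
    {A : ContinuousMultilinearMap ℂ (fun _ : Fin m => E) F} {r : ℝ}
    (hr : r ∈ FactorNormsViaL1 p A D) :
    IsRelPCompact p (polyEval A '' closedBall 0 1) ∧ mP p (polyEval A '' closedBall 0 1) ≤ r := by
  obtain ⟨N, -, Q, M, -, R, S, hR, -, hfac, rfl⟩ := hr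
  set a := supNorm (polyEval Q) with ha
  have ha0 : 0 ≤ a := supNorm_nonneg _
  have key : ∀ y : ℕ → (lp (fun _ : ℕ => ℂ) 1) ⧸ M, (Summable fun n => ‖y n‖ ^ p) →
      ⇑R '' closedBall 0 1 ⊆ pCo p y → ∃ x : ℕ → F, (Summable fun n => ‖x n‖ ^ p) ∧
        polyEval A '' closedBall 0 1 ⊆ pCo p x ∧
        (∑' n, ‖x n‖ ^ p) ^ (1 / p) ≤ a * ‖S‖ * (∑' n, ‖y n‖ ^ p) ^ (1 / p) := by
    intro y hy hRy
    obtain ⟨h1, h2⟩ := summable_and_tsum_const_mul_rpow hp (fun n => norm_nonneg (y n)) hy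
      (mul_nonneg ha0 (norm_nonneg S)) (a := fun n => ‖(a : ℂ) • S (y n)‖)
      (fun n => norm_nonneg _) (fun n => by
        rw [norm_smul, Complex.norm_real, Real.norm_of_nonneg ha0, mul_assoc]
        exact mul_le_mul_of_nonneg_left (S.le_opNorm _) ha0)
    refine ⟨_, h1, ?_, h2⟩
    rintro _ ⟨e, he, rfl⟩
    have hQe : ‖polyEval Q e‖ ≤ a := norm_polyEval_le_supNorm Q (mem_closedBall_zero_iff.1 he)
    rcases ha0.eq_or_lt with h0 | hpos
    · obtain ⟨α, hα, -⟩ := hRy ⟨0, by simp, rfl⟩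
      refine ⟨α, hα, ?_⟩
      have hA : polyEval A e = 0 := by
        rw [hfac, ← norm_le_zero_iff]
        refine ((S ∘L R).le_opNorm (polyEval Q e)).trans ?_
        exact mul_nonpos_of_nonneg_of_nonpos (norm_nonneg _) (hQe.trans h0.ge)
      simp only [hA, ← h0, Complex.ofReal_zero, zero_smul, smul_zero]
      exact hasSum_zero
    · obtain ⟨α, hα, hsum⟩ := hRy ⟨(a : ℂ)⁻¹ • polyEval Q e, by
        rw [mem_closedBall_zero_iff, norm_smul, norm_inv, Complex.norm_real,
          Real.norm_of_nonneg ha0, inv_mul_le_iff₀ hpos, mul_one]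
        exact hQe, rfl⟩
      refine ⟨α, hα, ?_⟩
      have h3 := (S.hasSum hsum).const_smul (a : ℂ)
      have h4 : (a : ℂ) • S (R ((a : ℂ)⁻¹ • polyEval Q e)) = polyEval A e := by
        rw [map_smul, map_smul, smul_inv_smul₀ (by exact_mod_cast hpos.ne'), hfac]
      rw [h4] at h3
      refine h3.congr_fun fun n => ?_
      change α n • (a : ℂ) • S (y n) = (a : ℂ) • S (α n • y n)
      rw [map_smul, smul_comm]
  obtain ⟨y₀, hy₀, hRy₀⟩ := hR
  obtain ⟨x, hx, hx', -⟩ := key y₀ hy₀ hRy₀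
  refine ⟨⟨x, hx, hx'⟩, ?_⟩
  have hle : ∀ y : ℕ → (lp (fun _ : ℕ => ℂ) 1) ⧸ M, (Summable fun n => ‖y n‖ ^ p) →
      ⇑R '' closedBall 0 1 ⊆ pCo p y →
      mP p (polyEval A '' closedBall 0 1) ≤ a * ‖S‖ * (∑' n, ‖y n‖ ^ p) ^ (1 / p) := by
    intro y hy hRy
    obtain ⟨x, hx, hx', hxle⟩ := key y hy hRy
    exact (mP_le hx hx').trans hxle
  rw [mul_right_comm]
  rcases (mul_nonneg ha0 (norm_nonneg S)).eq_or_lt with h0 | hpos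
  · simpa only [← h0, zero_mul] using hle y₀ hy₀ hRy₀
  · rw [← div_le_iff₀' hpos]
    refine le_csInf ⟨_, y₀, hy₀, hRy₀, rfl⟩ ?_
    rintro _ ⟨y, hy, hRy, rfl⟩
    rw [div_le_iff₀' hpos]
    exact hle y hy hRy

theorem isRelPCompact_iff_and_mP_eq {E F D : Type*}
    [NormedAddCommGroup E] [NormedSpace ℂ E] [NormedAddCommGroup F] [NormedSpace ℂ F]
    [CompleteSpace F] [SeminormedAddCommGroup D] [NormedSpace ℂ D] {p : ℝ} (hp : 1 ≤ p) {m : ℕ}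
    (A : ContinuousMultilinearMap ℂ (fun _ : Fin m => E) F)
    (hsym : ∀ (v : Fin m → E) (σ : Equiv.Perm (Fin m)), A (v ∘ σ) = A v)
    (c : ℕ → D →ₗ[ℂ] ℂ) (hc : ∀ d : D, ‖d‖ ≤ 1 → ConjUnitBall p fun n => c n d)
    (hc' : ∀ (α : ℕ → ℂ) (β : ℕ → ℝ), ConjUnitBall p α → (∀ n, 0 ≤ β n) → (∀ n, β n ≤ 1) →
      Tendsto β atTop (𝓝 0) → ∃ d : D, ‖d‖ ≤ 1 ∧ ∀ n, c n d = β n * α n) :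
    (IsRelPCompact p (polyEval A '' closedBall 0 1) ↔ (FactorNormsViaL1 p A D).Nonempty) ∧
      (IsRelPCompact p (polyEval A '' closedBall 0 1) →
        mP p (polyEval A '' closedBall 0 1) = sInf (FactorNormsViaL1 p A D)) := by
  have hne : IsRelPCompact p (polyEval A '' closedBall 0 1) →
      (FactorNormsViaL1 p A D).Nonempty := by
    rintro ⟨x, hx, hK⟩
    obtain ⟨r, hr, -⟩ := exists_factorNorm_le hp A hsym c hc hc' hx hK one_pos
    exact ⟨r, hr⟩
  refine ⟨⟨hne, fun ⟨r, hr⟩ => (isRelPCompact_and_mP_le_of_mem_factorNorms hp hr).1⟩,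
    fun h => le_antisymm ?_ ?_⟩
  · exact le_csInf (hne h) fun r hr => (isRelPCompact_and_mP_le_of_mem_factorNorms hp hr).2
  · obtain ⟨x₀, hx₀, hK₀⟩ := h
    refine le_csInf ⟨_, x₀, hx₀, hK₀, rfl⟩ ?_
    rintro _ ⟨x, hx, hK, rfl⟩
    refine ge_of_tendsto (x := 𝓝[>] (0 : ℝ))
      (f := fun ε => (∑' n, ‖x n‖ ^ p + ε) ^ (1 / p)) ?_ ?_
    · refine Tendsto.mono_left ?_ nhdsWithin_le_nhds
      have : Continuous fun ε : ℝ => (∑' n, ‖x n‖ ^ p + ε) ^ (1 / p) :=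
        (continuous_const.add continuous_id).rpow_const fun _ => Or.inr (by positivity)
      simpa using this.tendsto 0
    · filter_upwards [self_mem_nhdsWithin] with ε hε
      obtain ⟨r, hr, hle⟩ := exists_factorNorm_le hp A hsym c hc hc' hx hK hε
      refine (csInf_le ⟨mP p (polyEval A '' closedBall 0 1), fun r hr => ?_⟩ hr).trans hle
      exact (isRelPCompact_and_mP_le_of_mem_factorNorms hp hr).2

/-- **Proposition 2.3 ((i) ⇔ (iii)).** Let `E`, `F` be Banach spaces, `1 ≤ p < ∞`, and
`P : E → F` a continuous `m`-homogeneous polynomial.  Then `P` is `p`-compact if and only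
if there are a closed subspace `N ⊆ ℓ_q` (of `c₀` when `p = 1`), a continuous
`m`-homogeneous polynomial `Q : E → ℓ_q/N`, a closed subspace `M ⊆ ℓ₁`, a `p`-compact
operator `R : ℓ_q/N → ℓ₁/M` and a compact operator `S : ℓ₁/M → F` with `P = S ∘ R ∘ Q`.
Moreover, in this case `κ_p(P) = inf ‖Q‖ κ_p(R) ‖S‖` over all such factorizations. -/
theorem statement2 {E F : Type*}
    [NormedAddCommGroup E] [NormedSpace ℂ E] [CompleteSpace E]
    [NormedAddCommGroup F] [NormedSpace ℂ F] [CompleteSpace F]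
    (p : ℝ) (hp : 1 ≤ p) (m : ℕ)
    (A : ContinuousMultilinearMap ℂ (fun _ : Fin m => E) F)
    (hsym : ∀ (v : Fin m → E) (σ : Equiv.Perm (Fin m)), A (v ∘ σ) = A v) :
    (p = 1 →
      (IsRelPCompact p (polyEval A '' closedBall 0 1) ↔
        (FactorNormsViaL1 p A C₀(ℕ, ℂ)).Nonempty) ∧
      (IsRelPCompact p (polyEval A '' closedBall 0 1) →
        mP p (polyEval A '' closedBall 0 1) = sInf (FactorNormsViaL1 p A C₀(ℕ, ℂ)))) ∧
    (1 < p →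
      ∀ [_inst : Fact (1 ≤ ENNReal.ofReal (p / (p - 1)))],
      (IsRelPCompact p (polyEval A '' closedBall 0 1) ↔
        (FactorNormsViaL1 p A
          (lp (fun _ : ℕ => ℂ) (ENNReal.ofReal (p / (p - 1))))).Nonempty) ∧
      (IsRelPCompact p (polyEval A '' closedBall 0 1) →
        mP p (polyEval A '' closedBall 0 1) =
          sInf (FactorNormsViaL1 p A
            (lp (fun _ : ℕ => ℂ) (ENNReal.ofReal (p / (p - 1))))))) := by
  refine ⟨?_, fun hp1 _ => ?_⟩
  · rintro rfl
    refine isRelPCompact_iff_and_mP_eq (D := C₀(ℕ, ℂ)) le_rfl A hsym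
      (fun n => { toFun := fun d => d n, map_add' := fun _ _ => rfl, map_smul' := fun _ _ => rfl })
      (fun d hd => ?_) (fun α β hα hβ0 hβ1 hβ => ?_)
    · rw [ConjUnitBall, if_pos rfl]
      intro n
      exact (d.toBCF.norm_coe_le_norm n).trans hd
    · rw [ConjUnitBall, if_pos rfl] at hα
      have hle : ∀ n, ‖(β n : ℂ) * α n‖ ≤ β n := fun n => by
        rw [norm_mul, Complex.norm_real, Real.norm_of_nonneg (hβ0 n)]
        exact mul_le_of_le_one_right (hβ0 n) (hα n)
      have hlim : Tendsto (fun n => (β n : ℂ) * α n) (cocompact ℕ) (𝓝 0) := by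
        rw [cocompact_eq_cofinite, Nat.cofinite_eq_atTop]
        exact squeeze_zero_norm hle hβ
      let d : C₀(ℕ, ℂ) := ⟨⟨fun n => (β n : ℂ) * α n, continuous_of_discreteTopology⟩, hlim⟩
      refine ⟨d, ?_, fun n => rfl⟩
      rw [← ZeroAtInftyContinuousMap.norm_toBCF_eq_norm]
      exact (BoundedContinuousFunction.norm_le zero_le_one).2 fun n => (hle n).trans (hβ1 n)
  · have hq0 : 0 < p / (p - 1) := div_pos (by linarith) (by linarith)
    have hqr : (ENNReal.ofReal (p / (p - 1))).toReal = p / (p - 1) :=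
      ENNReal.toReal_ofReal hq0.le
    have hqpos : 0 < (ENNReal.ofReal (p / (p - 1))).toReal := by rwa [hqr]
    refine isRelPCompact_iff_and_mP_eq
      (D := lp (fun _ : ℕ => ℂ) (ENNReal.ofReal (p / (p - 1)))) hp A hsym
      (fun n => lp.evalₗ (𝕜 := ℂ) (fun _ : ℕ => ℂ) (ENNReal.ofReal (p / (p - 1))) n)
      (fun d hd => ?_) (fun α β hα hβ0 hβ1 _ => ?_)
    · rw [ConjUnitBall, if_neg hp1.ne']
      have h := lp.hasSum_norm hqpos d
      rw [hqr] at h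
      refine ⟨h.summable, h.tsum_eq.le.trans ?_⟩
      exact Real.rpow_le_one (norm_nonneg _) hd hq0.le
    · rw [ConjUnitBall, if_neg hp1.ne'] at hα
      have hle : ∀ n, ‖(β n : ℂ) * α n‖ ^ (p / (p - 1)) ≤ ‖α n‖ ^ (p / (p - 1)) := fun n => by
        refine Real.rpow_le_rpow (norm_nonneg _) ?_ hq0.le
        rw [norm_mul, Complex.norm_real, Real.norm_of_nonneg (hβ0 n)]
        exact mul_le_of_le_one_left (norm_nonneg _) (hβ1 n)
      have hsum : Summable fun n => ‖(β n : ℂ) * α n‖ ^ (p / (p - 1)) :=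
        hα.1.of_nonneg_of_le (fun n => Real.rpow_nonneg (norm_nonneg _) _) hle
      let d : lp (fun _ : ℕ => ℂ) (ENNReal.ofReal (p / (p - 1))) :=
        ⟨fun n => (β n : ℂ) * α n, memℓp_gen (by rwa [hqr])⟩
      refine ⟨d, lp.norm_le_of_tsum_le hqpos zero_le_one ?_, fun n => rfl⟩
      rw [hqr, Real.one_rpow]
      exact (hsum.tsum_le_tsum hle hα.1).trans hα.2
end
end
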